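/- For all integers n ≥ 2 and 0 ≤ j ≤ n, the number of partitions λ of n with crank(λ) ≥ j equals the number of partitions of n − j whose Frobenius symbol has no entry equal to j in its top row; equivalently, the number of partitions ν of n − j such that there is no index i with 1 ≤ i ≤ d and ν_i − i = j, where d = max{i : ν_i ≥ i} is the Durfee square side of ν (when n − j = 0, the empty partition is counted, its Frobenius symbol being empty). -/

import Mathlib

/-- Number of parts equal to 1 in a partition. -/
def partOmega {n : ℕ} (P : Nat.Partition n) : ℕ := P.parts.count 1

/-- Number of parts strictly greater than `partOmega P`. -/
def partMu {n : ℕ} (P : Nat.Partition n) : ℕ :=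
  (P.parts.filter (fun x => partOmega P < x)).card

/-- The crank of a partition: the largest part if there are no parts equal to 1,
and `μ(λ) - ω(λ)` otherwise. -/
def crank {n : ℕ} (P : Nat.Partition n) : ℤ :=
  if partOmega P = 0 then (P.parts.sup : ℤ)
  else (partMu P : ℤ) - (partOmega P : ℤ)

/-- The Durfee square side of a partition of `n`: the largest `d` such that the partition
has at least `d` parts each of size at least `d`. -/
def durfee {n : ℕ} (P : Nat.Partition n) : ℕ :=
  Nat.findGreatest (fun i => i ≤ Multiset.card (P.parts.filter (fun x => i ≤ x))) n

/-- The number of elements of `s` that are at least `a`. -/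
def numGe (s : Multiset ℕ) (a : ℕ) : ℕ := s.countP (a ≤ ·)

lemma numGe_add (s t : Multiset ℕ) (a : ℕ) : numGe (s + t) a = numGe s a + numGe t a :=
  Multiset.countP_add ..

lemma numGe_succ (s : Multiset ℕ) (a : ℕ) : numGe s a = numGe s (a + 1) + s.count a := by
  unfold numGe
  induction s using Multiset.induction_on with
  | empty => simp
  | cons x s ih =>
    simp only [Multiset.countP_cons, Multiset.count_cons, ih]
    split_ifs <;> omega

lemma numGe_anti (s : Multiset ℕ) {a b : ℕ} (h : a ≤ b) : numGe s b ≤ numGe s a := by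
  induction b, h using Nat.le_induction with
  | base => exact le_rfl
  | succ b _ ih => have := numGe_succ s b; omega

lemma numGe_le_card (s : Multiset ℕ) (a : ℕ) : numGe s a ≤ s.card :=
  Multiset.countP_le_card ..

lemma numGe_eq_card {s : Multiset ℕ} {a : ℕ} : numGe s a = s.card ↔ ∀ x ∈ s, a ≤ x :=
  Multiset.countP_eq_card

lemma numGe_eq_zero {s : Multiset ℕ} {a : ℕ} : numGe s a = 0 ↔ ∀ x ∈ s, x < a := by
  simp [numGe, Multiset.countP_eq_zero]

lemma le_sup_iff_numGe_pos (s : Multiset ℕ) (k : ℕ) : k + 1 ≤ s.sup ↔ numGe s (k + 1) ≠ 0 := by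
  have h : s.sup ≤ k ↔ ∀ x ∈ s, x ≤ k := Multiset.sup_le
  rw [Ne, numGe_eq_zero]
  simp only [Nat.lt_succ_iff, ← h]
  omega

lemma numGe_filter_ne_zero (s : Multiset ℕ) {a : ℕ} (ha : 1 ≤ a) :
    numGe (s.filter (· ≠ 0)) a = numGe s a := by
  unfold numGe
  rw [Multiset.countP_filter]
  exact Multiset.countP_congr rfl fun x _ => propext (by omega)

/-- A multiset can be cut at the threshold `d` into `k` large elements and the remaining
small ones, as soon as `k` lies between the numbers of elements `> d` and `≥ d`. -/
lemma exists_split {s : Multiset ℕ} {d k : ℕ} (h₁ : k ≤ numGe s d) (h₂ : numGe s (d + 1) ≤ k) :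
    ∃ A B : Multiset ℕ, A + B = s ∧ A.card = k ∧ (∀ a ∈ A, d ≤ a) ∧ ∀ b ∈ B, b ≤ d := by
  refine ⟨s.filter (d + 1 ≤ ·) + Multiset.replicate (k - numGe s (d + 1)) d,
    s.filter (· < d) + Multiset.replicate (numGe s d - k) d, ?_, ?_, ?_, ?_⟩
  · ext a
    have := numGe_succ s d
    simp only [Multiset.count_add, Multiset.count_filter, Multiset.count_replicate]
    rcases lt_trichotomy a d with h | rfl | h
    · simp [h, show ¬ d + 1 ≤ a by omega, h.ne']
    · simp
      omega
    · simp [show d + 1 ≤ a by omega, show ¬ a < d by omega, h.ne]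
  · rw [Multiset.card_add, ← Multiset.countP_eq_card_filter, Multiset.card_replicate]
    exact Nat.add_sub_of_le h₂
  · intro a ha
    simp only [Multiset.mem_add, Multiset.mem_filter, Multiset.mem_replicate] at ha
    omega
  · intro a ha
    simp only [Multiset.mem_add, Multiset.mem_filter, Multiset.mem_replicate] at ha
    omega

lemma numGe_add_of_le {A B : Multiset ℕ} {d : ℕ} (hB : ∀ b ∈ B, b ≤ d) :
    numGe (A + B) (d + 1) = numGe A (d + 1) := by
  rw [numGe_add, numGe_eq_zero.2 fun b hb => Nat.lt_succ_iff.2 (hB b hb), add_zero]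

lemma split_unique {A B A' B' : Multiset ℕ} {d : ℕ} (h : A + B = A' + B')
    (hc : A.card = A'.card) (hA : ∀ a ∈ A, d ≤ a) (hA' : ∀ a ∈ A', d ≤ a)
    (hB : ∀ b ∈ B, b ≤ d) (hB' : ∀ b ∈ B', b ≤ d) : A = A' ∧ B = B' := by
  have hAA : A = A' := by
    ext a
    rcases lt_trichotomy a d with ha | rfl | ha
    · rw [Multiset.count_eq_zero_of_notMem fun h => by have := hA a h; omega,
        Multiset.count_eq_zero_of_notMem fun h => by have := hA' a h; omega]
    · have h₁ := numGe_succ A a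
      have h₂ := numGe_succ A' a
      rw [numGe_eq_card.2 hA, ← numGe_add_of_le hB] at h₁
      rw [numGe_eq_card.2 hA', ← numGe_add_of_le hB', ← h] at h₂
      omega
    · have := congrArg (Multiset.count a) h
      rwa [Multiset.count_add, Multiset.count_add,
        Multiset.count_eq_zero_of_notMem (s := B) fun h => by have := hB a h; omega,
        Multiset.count_eq_zero_of_notMem (s := B') fun h => by have := hB' a h; omega] at this
  subst hAA
  exact ⟨rfl, add_left_cancel h⟩

lemma eq_of_filter_ne_zero_eq {s t : Multiset ℕ} (h : s.filter (· ≠ 0) = t.filter (· ≠ 0))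
    (hc : s.card = t.card) : s = t := by
  have key (u : Multiset ℕ) : u = u.filter (· ≠ 0) +
      Multiset.replicate (u.card - (u.filter (· ≠ 0)).card) 0 := by
    have h₁ := Multiset.filter_add_not (· ≠ 0) u
    simp only [not_not, Multiset.filter_eq'] at h₁
    have h₂ := congrArg Multiset.card h₁
    rw [Multiset.card_add, Multiset.card_replicate] at h₂
    conv_lhs => rw [← h₁]
    congr 2
    omega
  rw [key s, key t, h, hc]

/-- The conjugate of a multiset of numbers at most `n`, read off from its columns. -/
def conjParts (n : ℕ) (s : Multiset ℕ) : Multiset ℕ :=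
  ((Multiset.range n).map fun i => numGe s (i + 1)).filter (· ≠ 0)

lemma sum_numGe {n : ℕ} {s : Multiset ℕ} (hs : ∀ x ∈ s, x ≤ n) :
    ((Multiset.range n).map fun i => numGe s (i + 1)).sum = s.sum := by
  change ∑ i ∈ Finset.range n, numGe s (i + 1) = s.sum
  induction s using Multiset.induction_on with
  | empty => simp [numGe]
  | cons x s ih =>
    have hx : x ≤ n := hs x (Multiset.mem_cons_self ..)
    have : (Finset.range n).filter (· + 1 ≤ x) = Finset.range x := by
      ext i; simp only [Finset.mem_filter, Finset.mem_range]; omega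
    simp only [numGe, Multiset.countP_cons, Finset.sum_add_distrib, Multiset.sum_cons] at ih ⊢
    rw [ih fun y hy => hs y (Multiset.mem_cons_of_mem hy), Finset.sum_boole, this]
    simp [add_comm]

lemma le_numGe_conjParts {n : ℕ} {s : Multiset ℕ} (hs : ∀ x ∈ s, x ≤ n) {i a : ℕ} (hi : 1 ≤ i)
    (ha : 1 ≤ a) : a ≤ numGe (conjParts n s) i ↔ i ≤ numGe s a := by
  have h : numGe (conjParts n s) i =
      ((Finset.range n).filter fun k => i ≤ numGe s (k + 1)).card := by
    rw [conjParts, numGe_filter_ne_zero _ hi, numGe, Multiset.countP_map]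
    rfl
  rw [h]
  constructor
  · intro h'
    by_contra hlt
    have hsub : ((Finset.range n).filter fun k => i ≤ numGe s (k + 1)) ⊆ Finset.range (a - 1) := by
      intro k hk
      rw [Finset.mem_filter] at hk
      rw [Finset.mem_range]
      by_contra hk'
      have := numGe_anti s (show a ≤ k + 1 by omega)
      omega
    have := Finset.card_le_card hsub
    rw [Finset.card_range] at this
    omega
  · intro h'
    obtain ⟨x, hx, hax⟩ := Multiset.countP_pos.1 (show 0 < s.countP (a ≤ ·) from hi.trans h')
    have := hs x hx
    have hsub : Finset.range a ⊆ (Finset.range n).filter fun k => i ≤ numGe s (k + 1) := by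
      intro k hk
      rw [Finset.mem_range] at hk
      rw [Finset.mem_filter, Finset.mem_range]
      have := numGe_anti s (show k + 1 ≤ a by omega)
      omega
    simpa using Finset.card_le_card hsub

lemma partition_ext_numGe {n : ℕ} {P Q : n.Partition}
    (h : ∀ a, 1 ≤ a → numGe P.parts a = numGe Q.parts a) : P = Q := by
  apply Nat.Partition.ext
  ext a
  rcases Nat.eq_zero_or_pos a with rfl | ha
  · rw [Multiset.count_eq_zero_of_notMem fun h => (P.parts_pos h).ne rfl,
      Multiset.count_eq_zero_of_notMem fun h => (Q.parts_pos h).ne rfl]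
  · have h₁ := numGe_succ P.parts a
    have h₂ := numGe_succ Q.parts a
    rw [h a ha, h (a + 1) (by omega)] at h₁
    omega

/-- Conjugation of partitions. -/
def conjPartition {n : ℕ} (P : n.Partition) : n.Partition :=
  Nat.Partition.ofSums n ((Multiset.range n).map fun i => numGe P.parts (i + 1))
    ((sum_numGe fun _ => Nat.Partition.le_of_mem_parts).trans P.parts_sum)

lemma le_numGe_conjPartition {n : ℕ} (P : n.Partition) {i a : ℕ} (hi : 1 ≤ i) (ha : 1 ≤ a) :
    a ≤ numGe (conjPartition P).parts i ↔ i ≤ numGe P.parts a :=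
  le_numGe_conjParts (fun _ => Nat.Partition.le_of_mem_parts) hi ha

lemma conjPartition_involutive (n : ℕ) : Function.Involutive (@conjPartition n) := by
  intro P
  refine partition_ext_numGe fun a ha => le_antisymm ?_ ?_
  · rcases Nat.eq_zero_or_pos (numGe (conjPartition (conjPartition P)).parts a) with h | h
    · omega
    · rw [← le_numGe_conjPartition P h ha, ← le_numGe_conjPartition _ ha h]
  · rcases Nat.eq_zero_or_pos (numGe P.parts a) with h | h
    · omega
    · rw [le_numGe_conjPartition _ ha h, le_numGe_conjPartition P h ha]

/-- The number of partitions of `n` whose multiset of parts satisfies `p`. -/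
noncomputable def numPartitions (n : ℕ) (p : Multiset ℕ → Prop) : ℕ :=
  Nat.card {P : n.Partition // p P.parts}

lemma numPartitions_congr {n : ℕ} {p q : Multiset ℕ → Prop}
    (h : ∀ P : n.Partition, p P.parts ↔ q P.parts) : numPartitions n p = numPartitions n q :=
  Nat.card_congr (Equiv.subtypeEquivRight h)

lemma numPartitions_split (n : ℕ) (p q : Multiset ℕ → Prop) :
    numPartitions n p =
      numPartitions n (fun s => p s ∧ q s) + numPartitions n (fun s => p s ∧ ¬ q s) := by
  classical
  simp only [numPartitions, Nat.card_eq_fintype_card, Fintype.card_subtype]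
  rw [← Finset.card_filter_add_card_filter_not (s := Finset.univ.filter fun P => p P.parts)
    (fun P : n.Partition => q P.parts), Finset.filter_filter, Finset.filter_filter]

lemma numPartitions_conj (n : ℕ) (k : ℕ) :
    numPartitions n (fun s => numGe s 1 ≤ k) = numPartitions n (fun s => numGe s (k + 1) = 0) := by
  refine Nat.card_congr ((conjPartition_involutive n).toPerm.subtypeEquiv fun P => ?_)
  have := le_numGe_conjPartition P (show 1 ≤ k + 1 by omega) le_rfl
  simp only [Function.Involutive.coe_toPerm]
  omega

lemma numPartitions_one_mem (n : ℕ) (p : Multiset ℕ → Prop) :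
    numPartitions (n + 1) (fun s => p s ∧ 1 ∈ s) = numPartitions n (fun s => p (1 ::ₘ s)) := by
  symm
  refine Nat.card_eq_of_bijective
    (fun P => ⟨⟨1 ::ₘ P.1.parts, fun {i} hi => ?_, ?_⟩, P.2, Multiset.mem_cons_self ..⟩) ⟨?_, ?_⟩
  · rcases Multiset.mem_cons.1 hi with rfl | hi
    · exact one_pos
    · exact P.1.parts_pos hi
  · rw [Multiset.sum_cons, P.1.parts_sum, add_comm]
  · intro P Q h
    simp only [Subtype.mk.injEq, Nat.Partition.mk.injEq, Multiset.cons_inj_right] at h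
    exact Subtype.ext (Nat.Partition.ext h)
  · rintro ⟨P, hP, h1⟩
    have h := Multiset.cons_erase h1
    refine ⟨⟨⟨P.parts.erase 1, fun hi => P.parts_pos (Multiset.mem_of_mem_erase hi), ?_⟩, ?_⟩, ?_⟩
    · have := congrArg Multiset.sum h
      rw [Multiset.sum_cons, P.parts_sum] at this
      omega
    · simpa only [h] using hP
    · exact Subtype.ext (Nat.Partition.ext h)

lemma numGe_cons_one (s : Multiset ℕ) (k : ℕ) :
    numGe (1 ::ₘ s) k = numGe s k + if k ≤ 1 then 1 else 0 :=
  Multiset.countP_cons ..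

lemma numGe_one_pos {n : ℕ} (hn : 1 ≤ n) (P : n.Partition) : 1 ≤ numGe P.parts 1 := by
  by_contra h
  have h0 := numGe_eq_zero.1 (show numGe P.parts 1 = 0 by omega)
  have hs := P.parts_sum
  rw [Multiset.eq_zero_of_forall_notMem (s := P.parts) fun x hx => by
    have := h0 x hx
    have := P.parts_pos hx
    omega] at hs
  simp at hs
  omega

/-- Among partitions without ones, compare the largest part with the number of parts. -/
lemma numPartitions_largest_eq {n : ℕ} (hn : 2 ≤ n) (j : ℕ) :
    numPartitions n (fun s => 1 ∉ s ∧ j ≤ s.sup) =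
      numPartitions n (fun s => 1 ∉ s ∧ j + 1 ≤ numGe s 1) +
        numPartitions n (fun s => numGe s 1 = j) := by
  rcases j with _ | k
  · have h : numPartitions n (fun s => numGe s 1 = 0) = 0 := by
      have : IsEmpty {P : n.Partition // numGe P.parts 1 = 0} :=
        ⟨fun P => by have := numGe_one_pos (by omega) P.1; have := P.2; omega⟩
      exact Nat.card_of_isEmpty
    rw [h, add_zero]
    refine numPartitions_congr fun P => ?_
    have := numGe_one_pos (by omega) P
    simp only [zero_le, and_true, zero_add, this]
  · obtain ⟨m, rfl⟩ : ∃ m, n = m + 1 := ⟨n - 1, by omega⟩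
    have e1 := numPartitions_split (m + 1) (fun s => 1 ∉ s) (fun s => k + 1 ≤ s.sup)
    have e2 := numPartitions_split (m + 1) (fun s => 1 ∉ s) (fun s => k + 1 + 1 ≤ numGe s 1)
    have e3 := numPartitions_split (m + 1) (fun s => numGe s (k + 1) = 0) (fun s => 1 ∈ s)
    have e4 := numPartitions_split (m + 1) (fun s => numGe s 1 ≤ k + 1) (fun s => 1 ∈ s)
    have e5 := numPartitions_split (m + 1) (fun s => numGe s 1 ≤ k + 1) (fun s => numGe s 1 ≤ k)
    have c1 : numPartitions (m + 1) (fun s => 1 ∉ s ∧ ¬ k + 1 ≤ s.sup) =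
        numPartitions (m + 1) (fun s => numGe s (k + 1) = 0 ∧ 1 ∉ s) :=
      numPartitions_congr fun P => by rw [le_sup_iff_numGe_pos, not_not, and_comm]
    have c2 : numPartitions (m + 1) (fun s => 1 ∉ s ∧ ¬ k + 1 + 1 ≤ numGe s 1) =
        numPartitions (m + 1) (fun s => numGe s 1 ≤ k + 1 ∧ 1 ∉ s) :=
      numPartitions_congr fun P => by rw [not_le, Nat.lt_succ_iff, and_comm]
    have c3 : numPartitions (m + 1) (fun s => numGe s 1 ≤ k + 1 ∧ numGe s 1 ≤ k) =
        numPartitions (m + 1) (fun s => numGe s 1 ≤ k) :=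
      numPartitions_congr fun P => by omega
    have c4 : numPartitions (m + 1) (fun s => numGe s 1 ≤ k + 1 ∧ ¬ numGe s 1 ≤ k) =
        numPartitions (m + 1) (fun s => numGe s 1 = k + 1) :=
      numPartitions_congr fun P => by omega
    have o3 : numPartitions (m + 1) (fun s => numGe s (k + 1) = 0 ∧ 1 ∈ s) =
        numPartitions m (fun s => numGe s (k + 1) = 0) := by
      rw [numPartitions_one_mem]
      refine numPartitions_congr fun P => ?_
      rw [numGe_cons_one]
      rcases k with _ | k
      · have := numGe_one_pos (by omega) P
        simp only [zero_add]
        omega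
      · simp
    have o4 : numPartitions (m + 1) (fun s => numGe s 1 ≤ k + 1 ∧ 1 ∈ s) =
        numPartitions m (fun s => numGe s 1 ≤ k) := by
      rw [numPartitions_one_mem]
      exact numPartitions_congr fun P => by simp [numGe_cons_one]
    have d1 := numPartitions_conj (m + 1) k
    have d2 := numPartitions_conj m k
    omega

/-- Break every part `D + 1` into ones. -/
def melt (D : ℕ) (B : Multiset ℕ) : Multiset ℕ :=
  B.filter (· ≠ D + 1) + Multiset.replicate ((D + 1) * B.count (D + 1)) 1

/-- Glue as many ones as possible into parts `D + 1`. -/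
def unmelt (D : ℕ) (B : Multiset ℕ) : Multiset ℕ :=
  B.filter (· ≠ 1) + Multiset.replicate (B.count 1 / (D + 1)) (D + 1) +
    Multiset.replicate (B.count 1 % (D + 1)) 1

lemma sum_melt (D : ℕ) (B : Multiset ℕ) : (melt D B).sum = B.sum := by
  have h := congrArg Multiset.sum (Multiset.filter_add_not (· ≠ D + 1) B)
  simp only [not_not, Multiset.filter_eq', Multiset.sum_add, Multiset.sum_replicate,
    smul_eq_mul] at h
  rw [melt, Multiset.sum_add, Multiset.sum_replicate, smul_eq_mul, ← h]
  ring

lemma melt_bounds {D : ℕ} {B : Multiset ℕ} (hB : ∀ b ∈ B, 1 ≤ b ∧ b ≤ D + 1)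
    (h1 : B.count 1 ≤ D) : ∀ b ∈ melt D B, 1 ≤ b ∧ b ≤ D := by
  intro b hb
  simp only [melt, Multiset.mem_add, Multiset.mem_filter, Multiset.mem_replicate] at hb
  rcases hb with ⟨hb, hne⟩ | ⟨hne, rfl⟩
  · have := hB b hb
    omega
  · rcases D with _ | D
    · simp at hne h1
      contradiction
    · omega

lemma unmelt_bounds {D : ℕ} {B : Multiset ℕ} (hB : ∀ b ∈ B, 1 ≤ b ∧ b ≤ D) :
    ∀ b ∈ unmelt D B, 1 ≤ b ∧ b ≤ D + 1 := by
  intro b hb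
  simp only [unmelt, Multiset.mem_add, Multiset.mem_filter, Multiset.mem_replicate] at hb
  rcases hb with (⟨hb, -⟩ | ⟨-, rfl⟩) | ⟨-, rfl⟩
  · have := hB b hb
    omega
  · omega
  · omega

lemma eq_zero_of_bounds {B : Multiset ℕ} (hB : ∀ b ∈ B, 1 ≤ b ∧ b ≤ 0) : B = 0 :=
  Multiset.eq_zero_of_forall_notMem fun b hb => by have := hB b hb; omega

lemma count_one_unmelt_le {D : ℕ} {B : Multiset ℕ} (hB : ∀ b ∈ B, 1 ≤ b ∧ b ≤ D) :
    (unmelt D B).count 1 ≤ D := by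
  rcases D with _ | D
  · simp [eq_zero_of_bounds hB, unmelt]
  · have := Nat.mod_lt (B.count 1) (show 0 < D + 1 + 1 by omega)
    simp [unmelt, Multiset.count_replicate]
    omega

lemma melt_unmelt {D : ℕ} {B : Multiset ℕ} (hB : ∀ b ∈ B, 1 ≤ b ∧ b ≤ D) :
    melt D (unmelt D B) = B := by
  rcases D with _ | D
  · simp [eq_zero_of_bounds hB, unmelt, melt]
  · have h0 : B.count (D + 1 + 1) = 0 :=
      Multiset.count_eq_zero_of_notMem fun h => by have := hB _ h; omega
    have hdiv := Nat.div_add_mod (B.count 1) (D + 1 + 1)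
    ext a
    simp only [melt, unmelt, Multiset.count_add, Multiset.count_filter, Multiset.count_replicate,
      h0]
    by_cases h1 : a = 1
    · subst h1
      simp
      linarith
    · by_cases h2 : a = D + 1 + 1
      · subst h2
        simp [h0]
      · simp [h1, h2, Ne.symm h1, Ne.symm h2]

lemma unmelt_melt {D : ℕ} {B : Multiset ℕ} (hB : ∀ b ∈ B, 1 ≤ b ∧ b ≤ D + 1)
    (h1 : B.count 1 ≤ D) : unmelt D (melt D B) = B := by
  rcases D with _ | D
  · rw [Multiset.eq_zero_of_forall_notMem (s := B) fun b hb => by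
      have := hB b hb
      have := Multiset.count_pos.2 hb
      obtain rfl : b = 1 := by omega
      omega]
    simp [unmelt, melt]
  · have hc : (melt (D + 1) B).count 1 = B.count 1 + (D + 1 + 1) * B.count (D + 1 + 1) := by
      simp [melt]
    have hdiv : (melt (D + 1) B).count 1 / (D + 1 + 1) = B.count (D + 1 + 1) := by
      rw [hc, Nat.add_mul_div_left _ _ (by omega), Nat.div_eq_of_lt (by omega), zero_add]
    have hmod : (melt (D + 1) B).count 1 % (D + 1 + 1) = B.count 1 := by
      rw [hc, Nat.add_mul_mod_self_left, Nat.mod_eq_of_lt (by omega)]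
    rw [unmelt, hdiv, hmod]
    ext a
    simp only [melt, Multiset.count_add, Multiset.count_filter, Multiset.count_replicate]
    by_cases h1 : a = 1
    · subst h1
      simp
    · by_cases h2 : a = D + 1 + 1
      · subst h2
        simp
      · simp [h1, h2, Ne.symm h1, Ne.symm h2]

/-- A partition of `n` cut along a rectangle with `D + j` rows and `D + 1` columns: `A` holds the
rows through the rectangle, `B` those below it, at most `D` of which are ones. -/
structure IsUpperCut (n j : ℕ) (t : ℕ × Multiset ℕ × Multiset ℕ) : Prop where
  card_eq : t.2.1.card = t.1 + j
  le_of_mem : ∀ a ∈ t.2.1, t.1 + 1 ≤ a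
  bounds : ∀ b ∈ t.2.2, 1 ≤ b ∧ b ≤ t.1 + 1
  count_one_le : t.2.2.count 1 ≤ t.1
  sum_eq : t.2.1.sum + t.2.2.sum = n

/-- A partition of `n` cut along a rectangle with `D + j + 1` rows and `D` columns, whose last
row is exactly `D`: `A` holds the other rows through the rectangle, `B` those below it. -/
structure IsLowerCut (n j : ℕ) (t : ℕ × Multiset ℕ × Multiset ℕ) : Prop where
  card_eq : t.2.1.card = t.1 + j
  le_of_mem : ∀ a ∈ t.2.1, t.1 ≤ a
  bounds : ∀ b ∈ t.2.2, 1 ≤ b ∧ b ≤ t.1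
  sum_eq : t.2.1.sum + t.1 + t.2.2.sum = n

lemma sum_map_succ (A : Multiset ℕ) : (A.map (· + 1)).sum = A.sum + A.card := by
  simp [Multiset.sum_map_add]

lemma map_succ_map_pred {A : Multiset ℕ} {d : ℕ} (hA : ∀ a ∈ A, d + 1 ≤ a) :
    (A.map (· - 1)).map (· + 1) = A := by
  rw [Multiset.map_map]
  conv_rhs => rw [← Multiset.map_id A]
  refine Multiset.map_congr rfl fun a ha => ?_
  have := hA a ha
  simp only [Function.comp_apply, id_eq]
  omega

/-- Removing a column from the rectangle and melting the rows below it. -/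
def cutEquiv {n j : ℕ} (hj : j ≤ n) :
    {t // IsUpperCut n j t} ≃ {t // IsLowerCut (n - j) j t} where
  toFun t := ⟨(t.1.1, t.1.2.1.map (· - 1), melt t.1.1 t.1.2.2), by
    obtain ⟨⟨D, A, B⟩, h₁, h₂, h₃, h₄, h₅⟩ := t
    replace h₁ : A.card = D + j := h₁
    replace h₂ : ∀ a ∈ A, D + 1 ≤ a := h₂
    replace h₅ : A.sum + B.sum = n := h₅
    refine ⟨by simpa using h₁, ?_, melt_bounds h₃ h₄, ?_⟩
    · intro a ha
      obtain ⟨x, hx, rfl⟩ := Multiset.mem_map.1 ha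
      have := h₂ x hx
      simp only at this ⊢
      omega
    · have hA := sum_map_succ (A.map (· - 1))
      rw [map_succ_map_pred h₂, Multiset.card_map] at hA
      change (A.map (· - 1)).sum + D + (melt D B).sum = n - j
      rw [sum_melt]
      omega⟩
  invFun t := ⟨(t.1.1, t.1.2.1.map (· + 1), unmelt t.1.1 t.1.2.2), by
    obtain ⟨⟨D, A, B⟩, h₁, h₂, h₃, h₄⟩ := t
    replace h₁ : A.card = D + j := h₁
    replace h₃ : ∀ b ∈ B, 1 ≤ b ∧ b ≤ D := h₃
    replace h₄ : A.sum + D + B.sum = n - j := h₄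
    refine ⟨by simpa using h₁, ?_, unmelt_bounds h₃, count_one_unmelt_le h₃, ?_⟩
    · intro a ha
      obtain ⟨x, hx, rfl⟩ := Multiset.mem_map.1 ha
      have := h₂ x hx
      simp only at this ⊢
      omega
    · have hB := sum_melt D (unmelt D B)
      rw [melt_unmelt h₃] at hB
      change (A.map (· + 1)).sum + (unmelt D B).sum = n
      rw [sum_map_succ]
      omega⟩
  left_inv t := by
    obtain ⟨⟨D, A, B⟩, h⟩ := t
    exact Subtype.ext (Prod.ext rfl (Prod.ext (map_succ_map_pred h.le_of_mem)
      (unmelt_melt h.bounds h.count_one_le)))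
  right_inv t := by
    obtain ⟨⟨D, A, B⟩, h⟩ := t
    refine Subtype.ext (Prod.ext rfl (Prod.ext ?_ (melt_unmelt h.bounds)))
    simp

/-- The staircase condition `D + j ≤ numGe s (D + 1)` stops holding at only one place. -/
lemma crossing_unique {s : Multiset ℕ} {j D D' : ℕ} (h₁ : D + j ≤ numGe s (D + 1))
    (h₂ : numGe s (D + 1 + 1) ≤ D + j) (h₁' : D' + j ≤ numGe s (D' + 1))
    (h₂' : numGe s (D' + 1 + 1) ≤ D' + j) : D = D' := by
  rcases lt_trichotomy D D' with h | h | h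
  · have := numGe_anti s (show D + 1 + 1 ≤ D' + 1 by omega)
    omega
  · exact h
  · have := numGe_anti s (show D' + 1 + 1 ≤ D + 1 by omega)
    omega

lemma IsUpperCut.crossing {n j D : ℕ} {A B : Multiset ℕ} (h : IsUpperCut n j (D, A, B)) :
    D + j ≤ numGe (A + B) (D + 1) ∧ numGe (A + B) (D + 1 + 1) ≤ D + j := by
  have h₁ := numGe_eq_card.2 h.le_of_mem
  have h₂ := h.card_eq
  have h₃ := numGe_add_of_le (A := A) fun b hb => (h.bounds b hb).2
  have h₄ := numGe_le_card A (D + 1 + 1)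
  have h₅ := numGe_add A B (D + 1)
  simp only at *
  exact ⟨by omega, by omega⟩

/-- A staircase condition that holds at `D₀` has a last place `D ≥ D₀` where it holds. -/
lemma exists_crossing {s : Multiset ℕ} {j D₀ : ℕ} (h : D₀ + j ≤ numGe s (D₀ + 1)) :
    ∃ D, D₀ ≤ D ∧ D + j ≤ numGe s (D + 1) ∧ numGe s (D + 1 + 1) ≤ D + j := by
  let p : ℕ → Prop := fun D => D + j ≤ numGe s (D + 1)
  have hle := numGe_le_card s (D₀ + 1)
  refine ⟨Nat.findGreatest p s.card, Nat.le_findGreatest (by omega) h,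
    Nat.findGreatest_spec (P := p) (show D₀ ≤ s.card by omega) h, ?_⟩
  by_contra hlt
  have hn := numGe_le_card s (Nat.findGreatest p s.card + 1 + 1)
  have := Nat.le_findGreatest (P := p) (n := s.card) (m := Nat.findGreatest p s.card + 1)
    (by omega) (show Nat.findGreatest p s.card + 1 + j ≤
      numGe s (Nat.findGreatest p s.card + 1 + 1) by omega)
  omega

lemma card_upperCut (n j : ℕ) :
    Nat.card {t // IsUpperCut n j t} = numPartitions n (fun s => numGe s 1 = j ∨
      ∃ D, 1 ≤ D ∧ s.count 1 ≤ D ∧ D + j ≤ numGe s (D + 1)) := by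
  refine Nat.card_eq_of_bijective (fun t => ⟨⟨t.1.2.1 + t.1.2.2, fun {i} hi => ?_, ?_⟩, ?_⟩)
    ⟨?_, ?_⟩
  · rcases Multiset.mem_add.1 hi with hi | hi
    · have := t.2.le_of_mem i hi
      omega
    · exact (t.2.bounds i hi).1
  · rw [Multiset.sum_add, t.2.sum_eq]
  · obtain ⟨⟨D, A, B⟩, h⟩ := t
    have hcr := h.crossing
    have h₁ : A.card = D + j := h.card_eq
    have h₂ : ∀ a ∈ A, D + 1 ≤ a := h.le_of_mem
    have h₃ : ∀ b ∈ B, 1 ≤ b ∧ b ≤ D + 1 := h.bounds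
    have h₄ : B.count 1 ≤ D := h.count_one_le
    rcases D with _ | D
    · left
      have hB : B = 0 := Multiset.eq_zero_of_forall_notMem fun b hb => by
        have := h₃ b hb
        have := Multiset.count_pos.2 hb
        obtain rfl : b = 1 := by omega
        omega
      change numGe (A + B) (0 + 1) = j
      rw [hB, add_zero, numGe_eq_card.2 h₂]
      omega
    · right
      refine ⟨D + 1, by omega, ?_, hcr.1⟩
      change (A + B).count 1 ≤ D + 1
      rw [Multiset.count_add,
        Multiset.count_eq_zero_of_notMem (s := A) fun h => by have := h₂ 1 h; omega]
      omega
  · rintro ⟨⟨D, A, B⟩, h⟩ ⟨⟨D', A', B'⟩, h'⟩ heq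
    simp only [Subtype.mk.injEq, Nat.Partition.mk.injEq] at heq
    have hcr := h.crossing
    have hcr' := h'.crossing
    rw [← heq] at hcr'
    obtain rfl := crossing_unique hcr.1 hcr.2 hcr'.1 hcr'.2
    obtain ⟨rfl, rfl⟩ := split_unique heq (h.card_eq.trans h'.card_eq.symm) h.le_of_mem
      h'.le_of_mem (fun b hb => (h.bounds b hb).2) (fun b hb => (h'.bounds b hb).2)
    rfl
  · rintro ⟨P, hP⟩
    obtain ⟨D, hD, h₁, h₂⟩ : ∃ D, (D = 0 ∧ numGe P.parts 1 = j ∨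
        1 ≤ D ∧ P.parts.count 1 ≤ D) ∧ D + j ≤ numGe P.parts (D + 1) ∧
        numGe P.parts (D + 1 + 1) ≤ D + j := by
      rcases hP with h | ⟨D₀, h1, hc, h⟩
      · have := numGe_anti P.parts (show 1 ≤ 1 + 1 by omega)
        refine ⟨0, Or.inl ⟨rfl, h⟩, ?_, ?_⟩ <;> simp only [zero_add] <;> omega
      · obtain ⟨D, hle, h₁, h₂⟩ := exists_crossing h
        exact ⟨D, Or.inr ⟨by omega, by omega⟩, h₁, h₂⟩
    obtain ⟨A, B, hAB, hc, hA, hB⟩ := exists_split h₁ h₂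
    have hpos : ∀ b ∈ B, 1 ≤ b := fun b hb =>
      P.parts_pos (hAB ▸ Multiset.mem_add.2 (Or.inr hb))
    refine ⟨⟨(D, A, B), hc, hA, fun b hb => ⟨hpos b hb, hB b hb⟩, ?_, ?_⟩,
      Subtype.ext (Nat.Partition.ext hAB)⟩
    · rcases hD with ⟨rfl, h⟩ | ⟨-, h⟩
      · have hB0 := numGe_add A B 1
        rw [hAB, numGe_eq_card.2 hA, numGe_eq_card.2 hpos] at hB0
        have := Multiset.count_le_card 1 B
        simp only
        omega
      · rw [← hAB, Multiset.count_add] at h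
        exact (Nat.le_add_left _ _).trans h
    · rw [← P.parts_sum, ← hAB, Multiset.sum_add]

lemma IsLowerCut.crossing {n j D : ℕ} {A B : Multiset ℕ} (h : IsLowerCut n j (D, A, B)) :
    numGe (A + {D} + B) (D + 1) ≤ D + j ∧ D + j + 1 ≤ numGe (A + {D} + B) D := by
  have h₁ := numGe_eq_card.2 h.le_of_mem
  have h₂ := h.card_eq
  have h₃ := numGe_add_of_le (A := A + {D}) fun b hb => (h.bounds b hb).2
  have h₄ := numGe_le_card A (D + 1)
  have h₅ := numGe_add (A + {D}) B D
  have h₆ := numGe_add A {D} D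
  have h₇ := numGe_add A {D} (D + 1)
  have h₈ : numGe {D} (D + 1) = 0 := numGe_eq_zero.2 (by simp)
  have h₉ : numGe {D} D = 1 := numGe_eq_card.2 (by simp)
  simp only at *
  exact ⟨by omega, by omega⟩

lemma IsLowerCut.not_lt {n n' j D D' : ℕ} {A B A' B' : Multiset ℕ}
    (h : IsLowerCut n j (D, A, B)) (h' : IsLowerCut n' j (D', A', B'))
    (heq : (A + {D} + B).filter (· ≠ 0) = (A' + {D'} + B').filter (· ≠ 0)) : ¬ D < D' := by
  intro hlt
  have h₁ := h.crossing.1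
  have h₂ := h'.crossing.2
  rw [← numGe_filter_ne_zero _ (by omega)] at h₁ h₂
  rw [← heq] at h₂
  have := numGe_anti ((A + {D} + B).filter (· ≠ 0)) (show D + 1 ≤ D' by omega)
  omega

lemma filter_ne_zero_of_pos {s : Multiset ℕ} (h : ∀ x ∈ s, 1 ≤ x) : s.filter (· ≠ 0) = s :=
  Multiset.filter_eq_self.2 fun x hx => by have := h x hx; omega

lemma card_lowerCut (m j : ℕ) :
    Nat.card {t // IsLowerCut m j t} = numPartitions m (fun s => numGe s 1 ≤ j ∨
      ∃ D, 1 ≤ D ∧ numGe s (D + 1) ≤ D + j ∧ D + j + 1 ≤ numGe s D) := by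
  refine Nat.card_eq_of_bijective (fun t =>
    ⟨Nat.Partition.ofSums m (t.1.2.1 + {t.1.1} + t.1.2.2) ?_, ?_⟩) ⟨?_, ?_⟩
  · rw [Multiset.sum_add, Multiset.sum_add, Multiset.sum_singleton, t.2.sum_eq]
  · obtain ⟨⟨D, A, B⟩, h⟩ := t
    have hcr := h.crossing
    simp only [Nat.Partition.ofSums_parts]
    rcases D with _ | D
    · left
      rw [numGe_filter_ne_zero _ le_rfl]
      simpa using hcr.1
    · right
      refine ⟨D + 1, by omega, ?_⟩
      rwa [numGe_filter_ne_zero _ (by omega), numGe_filter_ne_zero _ (by omega)]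
  · rintro ⟨⟨D, A, B⟩, h⟩ ⟨⟨D', A', B'⟩, h'⟩ heq
    replace heq : (A + {D} + B).filter (· ≠ 0) = (A' + {D'} + B').filter (· ≠ 0) :=
      congrArg (fun P => P.1.parts) heq
    obtain rfl : D = D' := by
      have := h.not_lt h' heq
      have := h'.not_lt h heq.symm
      omega
    have hc : A.card = A'.card := h.card_eq.trans h'.card_eq.symm
    have hs : A + {D} + B = A' + {D} + B' := by
      rcases D with _ | D
      · obtain rfl : B = 0 := eq_zero_of_bounds h.bounds
        obtain rfl : B' = 0 := eq_zero_of_bounds h'.bounds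
        exact eq_of_filter_ne_zero_eq heq (by simp [hc])
      · have key {A B : Multiset ℕ} (h : IsLowerCut m j (D + 1, A, B)) :
            ∀ x ∈ A + {D + 1} + B, 1 ≤ x := by
          intro x hx
          simp only [Multiset.mem_add, Multiset.mem_singleton] at hx
          rcases hx with (hx | rfl) | hx
          · have := h.le_of_mem x hx
            simp only at this
            omega
          · omega
          · exact (h.bounds x hx).1
        rwa [filter_ne_zero_of_pos (key h), filter_ne_zero_of_pos (key h')] at heq
    rw [add_right_comm, add_right_comm A'] at hs
    obtain ⟨rfl, rfl⟩ := split_unique (add_right_cancel hs) hc h.le_of_mem h'.le_of_mem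
      (fun b hb => (h.bounds b hb).2) (fun b hb => (h'.bounds b hb).2)
    rfl
  · rintro ⟨P, hP⟩
    have hpos : ∀ x ∈ P.parts, 1 ≤ x := fun x hx => P.parts_pos hx
    rcases hP with h | ⟨D, hD, h₁, h₂⟩
    · rw [numGe_eq_card.2 hpos] at h
      refine ⟨⟨(0, P.parts + Multiset.replicate (j - P.parts.card) 0, 0), ?_, ?_, ?_, ?_⟩,
        Subtype.ext (Nat.Partition.ext ?_)⟩
      · simp
        omega
      · simp
      · simp
      · simp [P.parts_sum]
      · change (P.parts + Multiset.replicate (j - P.parts.card) 0 + {0} + 0).filter (· ≠ 0) =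
          P.parts
        have hr : (Multiset.replicate (j - P.parts.card) 0).filter (· ≠ 0) = 0 :=
          Multiset.filter_eq_nil.2 fun a ha => by simp [Multiset.eq_of_mem_replicate ha]
        rw [Multiset.filter_add, Multiset.filter_add, Multiset.filter_add, hr,
          filter_ne_zero_of_pos hpos]
        simp
    · obtain ⟨A, B, hAB, hc, hA, hB⟩ := exists_split h₂ (show numGe P.parts (D + 1) ≤ _ by omega)
      have hDA : D ∈ A := by
        by_contra hnot
        have hA' : ∀ a ∈ A, D + 1 ≤ a := fun a ha => by
          have := hA a ha
          have : a ≠ D := fun h => hnot (h ▸ ha)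
          omega
        rw [← hAB, numGe_add_of_le hB, numGe_eq_card.2 hA'] at h₁
        omega
      obtain ⟨A, rfl⟩ := Multiset.exists_cons_of_mem hDA
      rw [← Multiset.singleton_add, add_comm {D} A] at hAB hc hA
      have hsum := P.parts_sum
      refine ⟨⟨(D, A, B), ?_, ?_, ?_, ?_⟩, Subtype.ext (Nat.Partition.ext ?_)⟩
      · rw [Multiset.card_add, Multiset.card_singleton] at hc
        simp only
        omega
      · exact fun a ha => hA a (Multiset.mem_add.2 (Or.inl ha))
      · exact fun b hb => ⟨hpos b (hAB ▸ Multiset.mem_add.2 (Or.inr hb)), hB b hb⟩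
      · rw [← hAB, Multiset.sum_add, Multiset.sum_add, Multiset.sum_singleton] at hsum
        exact hsum
      · change (A + {D} + B).filter (· ≠ 0) = P.parts
        rw [hAB, filter_ne_zero_of_pos hpos]

lemma card_crank_ge {n : ℕ} (hn : 2 ≤ n) (j : ℕ) :
    Nat.card {P : n.Partition // (j : ℤ) ≤ crank P} = numPartitions n (fun s => numGe s 1 = j ∨
      ∃ D, 1 ≤ D ∧ s.count 1 ≤ D ∧ D + j ≤ numGe s (D + 1)) := by
  have h : Nat.card {P : n.Partition // (j : ℤ) ≤ crank P} = numPartitions n (fun s =>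
      (1 ∉ s ∧ j ≤ s.sup) ∨ (1 ∈ s ∧ s.count 1 + j ≤ numGe s (s.count 1 + 1))) := by
    refine Nat.card_congr (Equiv.subtypeEquivRight fun P => ?_)
    have hmu : partMu P = numGe P.parts (P.parts.count 1 + 1) :=
      (Multiset.countP_eq_card_filter ..).symm
    rw [crank, hmu, partOmega]
    by_cases h1 : 1 ∈ P.parts
    · have := (Multiset.count_pos.2 h1).ne'
      simp only [h1, this, if_false, not_true, false_and, false_or, true_and]
      omega
    · simp [h1]
  rw [h, numPartitions_split n _ (fun s => 1 ∈ s),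
    numPartitions_split n (fun s => numGe s 1 = j ∨ _) (fun s => numGe s 1 = j),
    numPartitions_split n (fun s => (numGe s 1 = j ∨ _) ∧ ¬ numGe s 1 = j) (fun s => 1 ∈ s)]
  have hl := numPartitions_largest_eq hn j
  have e1 : numPartitions n (fun s => ((1 ∉ s ∧ j ≤ s.sup) ∨
      (1 ∈ s ∧ s.count 1 + j ≤ numGe s (s.count 1 + 1))) ∧ ¬ 1 ∈ s) =
      numPartitions n (fun s => 1 ∉ s ∧ j ≤ s.sup) :=
    numPartitions_congr fun P => by tauto
  have e2 : numPartitions n (fun s => (numGe s 1 = j ∨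
      ∃ D, 1 ≤ D ∧ s.count 1 ≤ D ∧ D + j ≤ numGe s (D + 1)) ∧ numGe s 1 = j) =
      numPartitions n (fun s => numGe s 1 = j) :=
    numPartitions_congr fun P => by tauto
  have stair (s : Multiset ℕ) (D : ℕ) (hc : s.count 1 ≤ D) (hD : D + j ≤ numGe s (D + 1)) :
      s.count 1 + j ≤ numGe s (s.count 1 + 1) := by
    have := numGe_anti s (show s.count 1 + 1 ≤ D + 1 by omega)
    omega
  have e3 : numPartitions n (fun s => ((1 ∉ s ∧ j ≤ s.sup) ∨
      (1 ∈ s ∧ s.count 1 + j ≤ numGe s (s.count 1 + 1))) ∧ 1 ∈ s) =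
      numPartitions n (fun s => ((numGe s 1 = j ∨
      ∃ D, 1 ≤ D ∧ s.count 1 ≤ D ∧ D + j ≤ numGe s (D + 1)) ∧ ¬ numGe s 1 = j) ∧ 1 ∈ s) := by
    refine numPartitions_congr fun P => ?_
    constructor
    · rintro ⟨⟨h, -⟩ | ⟨-, h⟩, h1⟩
      · contradiction
      · have hpos := Multiset.count_pos.2 h1
        have := numGe_anti P.parts (show 1 ≤ P.parts.count 1 + 1 by omega)
        exact ⟨⟨Or.inr ⟨_, hpos, le_rfl, h⟩, by omega⟩, h1⟩
    · rintro ⟨⟨h | ⟨D, -, hc, hD⟩, hne⟩, h1⟩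
      · contradiction
      · exact ⟨Or.inr ⟨h1, stair _ D hc hD⟩, h1⟩
  have e4 : numPartitions n (fun s => 1 ∉ s ∧ j + 1 ≤ numGe s 1) =
      numPartitions n (fun s => ((numGe s 1 = j ∨
      ∃ D, 1 ≤ D ∧ s.count 1 ≤ D ∧ D + j ≤ numGe s (D + 1)) ∧ ¬ numGe s 1 = j) ∧ ¬ 1 ∈ s) := by
    refine numPartitions_congr fun P => ?_
    have hs := numGe_succ P.parts 1
    constructor
    · rintro ⟨h1, h⟩
      have h0 := Multiset.count_eq_zero_of_notMem h1
      exact ⟨⟨Or.inr ⟨1, le_rfl, by omega, by omega⟩, by omega⟩, h1⟩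
    · rintro ⟨⟨h | ⟨D, h1D, -, hD⟩, hne⟩, h1⟩
      · contradiction
      · have := numGe_anti P.parts (show 1 ≤ D + 1 by omega)
        exact ⟨h1, by omega⟩
  omega

lemma le_durfee {n : ℕ} (P : n.Partition) {i j : ℕ} (hi : 1 ≤ i)
    (h : i ≤ numGe P.parts (i + j)) : i ≤ durfee P := by
  obtain ⟨x, hx, hix⟩ := Multiset.countP_pos.1 (show 0 < P.parts.countP (i + j ≤ ·) from hi.trans h)
  have := Nat.Partition.le_of_mem_parts hx
  refine Nat.le_findGreatest (by omega) ?_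
  rw [← Multiset.countP_eq_card_filter]
  exact h.trans (numGe_anti _ (by omega))

/-- The strictly decreasing sequence `numGe s i - i - j` avoids `0` iff it jumps over it. -/
lemma avoids_iff_crossing (s : Multiset ℕ) (j : ℕ) :
    (¬ ∃ i, 1 ≤ i ∧ numGe s i = i + j) ↔ (numGe s 1 ≤ j ∨
      ∃ D, 1 ≤ D ∧ numGe s (D + 1) ≤ D + j ∧ D + j + 1 ≤ numGe s D) := by
  constructor
  · intro h
    push Not at h
    rcases Nat.lt_or_ge j (numGe s 1) with hlt | hle
    · right
      obtain ⟨D, -, h₁, h₂⟩ := exists_crossing (s := s) (D₀ := 0) (j := j + 1)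
        (by rw [zero_add, zero_add]; exact hlt)
      have := h (D + 1) (by omega)
      have := h (D + 1 + 1) (by omega)
      exact ⟨D + 1, by omega, by omega, by omega⟩
    · exact Or.inl hle
  · rintro h ⟨i, hi, he⟩
    rcases h with h | ⟨D, hD, h₁, h₂⟩
    · have := numGe_anti s hi
      omega
    · rcases Nat.lt_or_ge D i with hlt | hle
      · have := numGe_anti s (show D + 1 ≤ i from hlt)
        omega
      · have := numGe_anti s hle
        omega

lemma card_frobenius_avoiding (m j : ℕ) :
    Nat.card {ν : m.Partition // ¬ ∃ i : ℕ, 1 ≤ i ∧ i ≤ durfee ν ∧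
        i ≤ Multiset.card (ν.parts.filter (fun x => i + j ≤ x)) ∧
        Multiset.card (ν.parts.filter (fun x => i + j + 1 ≤ x)) < i} =
      numPartitions m (fun s => numGe s 1 ≤ j ∨
        ∃ D, 1 ≤ D ∧ numGe s (D + 1) ≤ D + j ∧ D + j + 1 ≤ numGe s D) := by
  refine Nat.card_congr ((conjPartition_involutive m).toPerm.subtypeEquiv fun ν => ?_)
  rw [Function.Involutive.coe_toPerm]
  refine Iff.trans (not_congr ?_) (avoids_iff_crossing (conjPartition ν).parts j)
  refine exists_congr fun i => ?_
  simp only [← Multiset.countP_eq_card_filter]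
  change 1 ≤ i ∧ i ≤ durfee ν ∧ i ≤ numGe ν.parts (i + j) ∧ numGe ν.parts (i + j + 1) < i ↔ _
  refine and_congr_right fun hi => ?_
  have h₁ := le_numGe_conjPartition ν hi (show 1 ≤ i + j by omega)
  have h₂ := le_numGe_conjPartition ν hi (show 1 ≤ i + j + 1 by omega)
  have h₃ := le_durfee ν (j := j) hi
  omega

/-- For `n ≥ 2` and `0 ≤ j ≤ n`, the number of partitions of `n` with crank at least `j`
equals the number of partitions `ν` of `n - j` whose Frobenius symbol has no entry `j` in
its top row, i.e. there is no index `i` with `1 ≤ i ≤ d` (where `d` is the Durfee square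
side of `ν`) such that `ν_i = i + j`; the condition `ν_i = i + j` is expressed as: `ν` has
at least `i` parts `≥ i + j` but fewer than `i` parts `≥ i + j + 1`. -/
theorem stmt_19 (n j : ℕ) (hn : 2 ≤ n) (hj : j ≤ n) :
    Nat.card {P : Nat.Partition n // (j : ℤ) ≤ crank P} =
      Nat.card {ν : Nat.Partition (n - j) //
        ¬ ∃ i : ℕ, 1 ≤ i ∧ i ≤ durfee ν ∧
          i ≤ Multiset.card (ν.parts.filter (fun x => i + j ≤ x)) ∧
          Multiset.card (ν.parts.filter (fun x => i + j + 1 ≤ x)) < i} := by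
  rw [card_crank_ge hn, ← card_upperCut, Nat.card_congr (cutEquiv hj), card_lowerCut,
    card_frobenius_avoiding]
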